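/- Grünbaum's inequality: let P ⊆ ℝ^d be a convex body with centroid c = (∫_P x dx)/vol(P), and let w ∈ ℝ^d be nonzero. For the halfspace H = {x : ⟨w, x − c⟩ ≥ 0}, it holds that vol(P ∩ H)/vol(P) ≥ (d/(d+1))^d ≥ 1/e. -/

import Mathlib

open MeasureTheory RealInnerProductSpace
open scoped ENNReal Pointwise

theorem ENNReal.rpow_mul_rpow_le_add {p q : ℝ} (hp : 0 < p) (hq : 0 < q) (hpq : p + q = 1)
    (a b : ℝ≥0∞) :
    a ^ p * b ^ q ≤ ENNReal.ofReal p * a + ENNReal.ofReal q * b := by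
  rcases eq_or_ne a ∞ with rfl | ha
  · simp [ENNReal.mul_top, hp]
  rcases eq_or_ne b ∞ with rfl | hb
  · simp [ENNReal.mul_top, hq]
  lift a to NNReal using ha
  lift b to NNReal using hb
  have h := NNReal.geom_mean_le_arith_mean2_weighted p.toNNReal q.toNNReal a b
    (by rw [← Real.toNNReal_add hp.le hq.le, hpq, Real.toNNReal_one])
  rw [Real.coe_toNNReal p hp.le, Real.coe_toNNReal q hq.le] at h
  rw [← ENNReal.coe_rpow_of_nonneg _ hp.le, ← ENNReal.coe_rpow_of_nonneg _ hq.le]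
  rw [← ENNReal.coe_mul]
  exact ENNReal.coe_le_coe.2 h

/-- The one-dimensional Brunn–Minkowski inequality for compact sets. -/
theorem IsCompact.volume_add_volume_le {A B C : Set ℝ} (hA : IsCompact A) (hB : IsCompact B)
    (hA' : A.Nonempty) (hB' : B.Nonempty) (h : ∀ a ∈ A, ∀ b ∈ B, a + b ∈ C) :
    volume A + volume B ≤ volume C := by
  obtain ⟨a, ha, hamax⟩ := hA.exists_isGreatest hA'
  obtain ⟨b, hb, hbmin⟩ := hB.exists_isLeast hB'
  have hinter : (b +ᵥ A) ∩ (a +ᵥ B) ⊆ {a + b} := by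
    rintro _ ⟨⟨x, hx, rfl⟩, ⟨y, hy, hxy⟩⟩
    have h1 := hamax hx
    have h2 := hbmin hy
    simp only [vadd_eq_add] at hxy ⊢
    rw [Set.mem_singleton_iff]
    linarith
  have hdisj : AEDisjoint volume (b +ᵥ A) (a +ᵥ B) :=
    measure_mono_null hinter (by simp)
  calc volume A + volume B = volume (b +ᵥ A) + volume (a +ᵥ B) := by
        rw [measure_vadd, measure_vadd]
    _ = volume ((b +ᵥ A) ∪ (a +ᵥ B)) :=
        (measure_union₀ (hB.vadd a).measurableSet.nullMeasurableSet hdisj).symm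
    _ ≤ volume C := measure_mono <| by
        rintro _ (⟨x, hx, rfl⟩ | ⟨y, hy, rfl⟩)
        · simpa [add_comm] using h x hx b hb
        · exact h a ha y hy

/-- The one-dimensional Brunn–Minkowski inequality for measurable sets. -/
theorem MeasurableSet.volume_add_volume_le {A B C : Set ℝ} (hA : MeasurableSet A)
    (hB : MeasurableSet B) (hA' : A.Nonempty) (hB' : B.Nonempty)
    (h : ∀ a ∈ A, ∀ b ∈ B, a + b ∈ C) :
    volume A + volume B ≤ volume C := by
  obtain ⟨a, ha⟩ := hA'
  obtain ⟨b, hb⟩ := hB'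
  rw [hA.measure_eq_iSup_isCompact, hB.measure_eq_iSup_isCompact]
  refine ENNReal.biSup_add_biSup_le' (p := fun K ↦ K ⊆ A ∧ IsCompact K)
    (q := fun K ↦ K ⊆ B ∧ IsCompact K) ?_ ?_ ?_ |> fun h ↦ by simpa [iSup_and] using h
  · exact ⟨∅, by simp⟩
  · exact ⟨∅, by simp⟩
  rintro K ⟨hKA, hK⟩ L ⟨hLB, hL⟩
  refine (add_le_add (measure_mono (Set.subset_insert a K))
    (measure_mono (Set.subset_insert b L))).trans ?_
  exact (hK.insert a).volume_add_volume_le (hL.insert b) (Set.insert_nonempty _ _)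
    (Set.insert_nonempty _ _) fun x hx y hy ↦
      h x (Set.insert_subset ha hKA hx) y (Set.insert_subset hb hLB hy)

theorem MeasurableSet.mul_volume_add_mul_volume_le {A B C : Set ℝ} {p q : ℝ} (hp : 0 < p)
    (hq : 0 < q) (hA : MeasurableSet A)
    (hB : MeasurableSet B) (hA' : A.Nonempty) (hB' : B.Nonempty)
    (h : ∀ a ∈ A, ∀ b ∈ B, p * a + q * b ∈ C) :
    ENNReal.ofReal p * volume A + ENNReal.ofReal q * volume B ≤ volume C := by
  have key := (hA.const_smul₀ p).volume_add_volume_le (hB.const_smul₀ q) (C := C)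
    (hA'.smul_set) (hB'.smul_set) (by
      rintro _ ⟨a, ha, rfl⟩ _ ⟨b, hb, rfl⟩
      exact h a ha b hb)
  simpa [abs_of_pos hp, abs_of_pos hq] using key

theorem lintegral_eq_lintegral_volume_lt_toReal {f : ℝ → ℝ≥0∞} (hf : Measurable f)
    (hf' : ∀ x, f x ≠ ∞) :
    ∫⁻ x, f x = ∫⁻ t in Set.Ioi (0 : ℝ), volume {x | t < (f x).toReal} := by
  rw [← lintegral_eq_lintegral_meas_lt volume (Filter.Eventually.of_forall fun x ↦
    ENNReal.toReal_nonneg) hf.ennreal_toReal.aemeasurable]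
  simp [ENNReal.ofReal_toReal, hf']

theorem prekopa_leindler_real_of_iSup_eq_one {p q : ℝ} (hp : 0 < p) (hq : 0 < q)
    {f g h : ℝ → ℝ≥0∞} (hf : Measurable f)
    (hg : Measurable g) (hh : Measurable h) (hf1 : ⨆ x, f x = 1) (hg1 : ⨆ x, g x = 1)
    (H : ∀ x y, f x ^ p * g y ^ q ≤ h (p * x + q * y)) (hpq : p + q = 1) :
    ENNReal.ofReal p * (∫⁻ x, f x) + ENNReal.ofReal q * (∫⁻ x, g x) ≤ ∫⁻ x, h x := by
  have hfle : ∀ x, f x ≤ 1 := fun x ↦ hf1 ▸ le_iSup f x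
  have hgle : ∀ x, g x ≤ 1 := fun x ↦ hg1 ▸ le_iSup g x
  have fin : ∀ {u : ℝ≥0∞}, u ≤ 1 → u ≠ ∞ := fun hu ↦ ne_top_of_le_ne_top ENNReal.one_ne_top hu
  have hk : Measurable fun x ↦ min (h x) 1 := hh.min measurable_const
  refine le_trans ?_ (lintegral_mono fun x ↦ min_le_left (h x) 1)
  rw [lintegral_eq_lintegral_volume_lt_toReal hf fun x ↦ fin (hfle x),
    lintegral_eq_lintegral_volume_lt_toReal hg fun x ↦ fin (hgle x),
    lintegral_eq_lintegral_volume_lt_toReal hk fun x ↦ fin (min_le_right _ _),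
    ← lintegral_const_mul' _ _ ENNReal.ofReal_ne_top,
    ← lintegral_const_mul' _ _ ENNReal.ofReal_ne_top]
  refine (le_lintegral_add _ _).trans (setLIntegral_mono' measurableSet_Ioi fun t ht ↦ ?_)
  have ht0 : (0 : ℝ) < t := ht
  have hlt : ∀ {u : ℝ≥0∞}, u ≤ 1 → (t < u.toReal ↔ ENNReal.ofReal t < u) := fun hu ↦
    (ENNReal.ofReal_lt_iff_lt_toReal ht0.le (fin hu)).symm
  simp only [hlt (hfle _), hlt (hgle _), hlt (min_le_right (h _) 1)]
  rcases le_or_gt 1 t with h1 | h1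
  · have : ∀ {u : ℝ≥0∞}, u ≤ 1 → ¬ ENNReal.ofReal t < u := fun hu ↦
      not_lt.2 (hu.trans (ENNReal.one_le_ofReal.2 h1))
    simp [this (hfle _), this (hgle _)]
  · have h1' : ENNReal.ofReal t < 1 := ENNReal.ofReal_lt_one.2 h1
    refine MeasurableSet.mul_volume_add_mul_volume_le hp hq
      (measurableSet_lt measurable_const hf) (measurableSet_lt measurable_const hg)
      (lt_iSup_iff.1 (h1'.trans_eq hf1.symm)) (lt_iSup_iff.1 (h1'.trans_eq hg1.symm))
      fun a ha b hb ↦ ?_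
    refine lt_min (lt_of_lt_of_le ?_ (H a b)) h1'
    calc ENNReal.ofReal t = ENNReal.ofReal t ^ p * ENNReal.ofReal t ^ q := by
          rw [← ENNReal.rpow_add_of_nonneg _ _ hp.le hq.le, hpq, ENNReal.rpow_one]
      _ < f a ^ p * g b ^ q :=
          ENNReal.mul_lt_mul (ENNReal.rpow_lt_rpow ha hp) (ENNReal.rpow_lt_rpow hb hq)

theorem prekopa_leindler_real_of_bounded {p q : ℝ} (hp : 0 < p) (hq : 0 < q) (hpq : p + q = 1)
    {f g h : ℝ → ℝ≥0∞} (hf : Measurable f)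
    (hg : Measurable g) (hh : Measurable h) (hf1 : ⨆ x, f x ≠ ∞) (hg1 : ⨆ x, g x ≠ ∞)
    (H : ∀ x y, f x ^ p * g y ^ q ≤ h (p * x + q * y)) :
    (∫⁻ x, f x) ^ p * (∫⁻ x, g x) ^ q ≤ ∫⁻ x, h x := by
  rcases eq_or_ne (⨆ x, f x) 0 with hf0 | hf0
  · simp [ENNReal.iSup_eq_zero.1 hf0, hp]
  rcases eq_or_ne (⨆ x, g x) 0 with hg0 | hg0
  · simp [ENNReal.iSup_eq_zero.1 hg0, hq]
  set a := ⨆ x, f x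
  set b := ⨆ x, g x
  have key := prekopa_leindler_real_of_iSup_eq_one hp hq (hf.const_mul a⁻¹) (hg.const_mul b⁻¹)
    (hh.const_mul ((a⁻¹) ^ p * (b⁻¹) ^ q))
    (by rw [← ENNReal.mul_iSup, ENNReal.inv_mul_cancel hf0 hf1])
    (by rw [← ENNReal.mul_iSup, ENNReal.inv_mul_cancel hg0 hg1])
    (fun x y ↦ by
      rw [ENNReal.mul_rpow_of_nonneg _ _ hp.le, ENNReal.mul_rpow_of_nonneg _ _ hq.le,
        mul_mul_mul_comm]
      gcongr
      exact H x y) hpq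
  have key2 := (ENNReal.rpow_mul_rpow_le_add hp hq hpq _ _).trans key
  rw [lintegral_const_mul _ hf, lintegral_const_mul _ hg, lintegral_const_mul _ hh,
    ENNReal.mul_rpow_of_nonneg _ _ hp.le, ENNReal.mul_rpow_of_nonneg _ _ hq.le,
    mul_mul_mul_comm] at key2
  have ha : (a⁻¹) ^ p ≠ 0 ∧ (a⁻¹) ^ p ≠ ∞ := by
    simp [ENNReal.rpow_eq_zero_iff, ENNReal.rpow_eq_top_iff, hf0, hf1, hp.not_gt]
  have hb : (b⁻¹) ^ q ≠ 0 ∧ (b⁻¹) ^ q ≠ ∞ := by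
    simp [ENNReal.rpow_eq_zero_iff, ENNReal.rpow_eq_top_iff, hg0, hg1, hq.not_gt]
  exact (ENNReal.mul_le_mul_iff_right (mul_ne_zero ha.1 hb.1) (ENNReal.mul_ne_top ha.2 hb.2)).1 key2

theorem tendsto_lintegral_min_natCast {f : ℝ → ℝ≥0∞} (hf : Measurable f) :
    Filter.Tendsto (fun n : ℕ ↦ ∫⁻ x, min (f x) n) Filter.atTop (nhds (∫⁻ x, f x)) := by
  refine lintegral_tendsto_of_tendsto_of_monotone
    (fun n ↦ (hf.min measurable_const).aemeasurable) ?_ ?_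
  · exact Filter.Eventually.of_forall fun x m n hmn ↦ min_le_min le_rfl (by exact_mod_cast hmn)
  · refine Filter.Eventually.of_forall fun x ↦ ?_
    simpa using (tendsto_const_nhds (x := f x)).min ENNReal.tendsto_nat_nhds_top

/-- The one-dimensional Prékopa–Leindler inequality. -/
theorem prekopa_leindler_real {p q : ℝ} (hp : 0 < p) (hq : 0 < q) (hpq : p + q = 1)
    {f g h : ℝ → ℝ≥0∞} (hf : Measurable f)
    (hg : Measurable g) (hh : Measurable h)
    (H : ∀ x y, f x ^ p * g y ^ q ≤ h (p * x + q * y)) :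
    (∫⁻ x, f x) ^ p * (∫⁻ x, g x) ^ q ≤ ∫⁻ x, h x := by
  rcases eq_or_ne (∫⁻ x, f x) 0 with hf0 | hf0
  · simp [hf0, hp]
  rcases eq_or_ne (∫⁻ x, g x) 0 with hg0 | hg0
  · simp [hg0, hq]
  refine le_of_tendsto' (ENNReal.Tendsto.mul ((tendsto_lintegral_min_natCast hf).ennrpow_const p)
    (Or.inl ?_) ((tendsto_lintegral_min_natCast hg).ennrpow_const q) (Or.inl ?_)) fun n ↦ ?_
  · simp [ENNReal.rpow_eq_zero_iff, hf0, hp.not_gt]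
  · simp [ENNReal.rpow_eq_zero_iff, hg0, hq.not_gt]
  refine prekopa_leindler_real_of_bounded hp hq hpq (hf.min measurable_const)
    (hg.min measurable_const) hh ?_ ?_ fun x y ↦ ?_
  · exact ne_top_of_le_ne_top (ENNReal.natCast_ne_top n) (iSup_le fun x ↦ min_le_right _ _)
  · exact ne_top_of_le_ne_top (ENNReal.natCast_ne_top n) (iSup_le fun x ↦ min_le_right _ _)
  · refine le_trans ?_ (H x y)
    gcongr <;> exact min_le_left _ _

/-- The Prékopa–Leindler inequality. -/
theorem prekopa_leindler_pi {p q : ℝ} (hp : 0 < p) (hq : 0 < q) (hpq : p + q = 1) (n : ℕ)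
    {f g h : (Fin n → ℝ) → ℝ≥0∞} (hf : Measurable f)
    (hg : Measurable g) (hh : Measurable h)
    (H : ∀ x y, f x ^ p * g y ^ q ≤ h (p • x + q • y)) :
    (∫⁻ x, f x) ^ p * (∫⁻ x, g x) ^ q ≤ ∫⁻ x, h x := by
  induction n with
  | zero =>
    have huniv : volume (Set.univ : Set (Fin 0 → ℝ)) = 1 := by simp [volume_pi]
    simp only [lintegral_unique, huniv, mul_one]
    exact (H _ _).trans_eq (congrArg h (Subsingleton.elim _ _))
  | succ n ih =>
    let e := (MeasurableEquiv.piFinSuccAbove (fun _ : Fin (n + 1) ↦ ℝ) 0).symm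
    have he : ∀ u : (Fin (n + 1) → ℝ) → ℝ≥0∞, Measurable u →
        Measurable (fun z ↦ u (e z)) ∧ ∫⁻ x, u x = ∫⁻ t, ∫⁻ y, u (e (t, y)) := by
      intro u hu
      have hm : Measurable (fun z ↦ u (e z)) := hu.comp e.measurable
      refine ⟨hm, ?_⟩
      rw [← (volume_preserving_piFinSuccAbove (fun _ : Fin (n + 1) ↦ ℝ) 0).symm.lintegral_comp hu]
      exact lintegral_prod _ hm.aemeasurable
    have hadd : ∀ s t x y, e (p * s + q * t, p • x + q • y) = p • e (s, x) + q • e (t, y) := by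
      intro s t x y
      ext i
      refine Fin.cases ?_ (fun j ↦ ?_) i <;>
        simp [e, MeasurableEquiv.piFinSuccAbove]
    rw [(he f hf).2, (he g hg).2, (he h hh).2]
    refine prekopa_leindler_real hp hq hpq (he f hf).1.lintegral_prod_right'
      (he g hg).1.lintegral_prod_right' (he h hh).1.lintegral_prod_right' fun s t ↦ ?_
    refine ih ((he f hf).1.comp measurable_prodMk_left) ((he g hg).1.comp measurable_prodMk_left)
      ((he h hh).1.comp measurable_prodMk_left) fun x y ↦ ?_
    simp only [hadd]
    exact H _ _

/-- The Prékopa–Leindler inequality. -/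
theorem prekopa_leindler {p q : ℝ} (hp : 0 < p) (hq : 0 < q) (hpq : p + q = 1) {n : ℕ}
    {f g h : EuclideanSpace ℝ (Fin n) → ℝ≥0∞} (hf : Measurable f)
    (hg : Measurable g) (hh : Measurable h)
    (H : ∀ x y, f x ^ p * g y ^ q ≤ h (p • x + q • y)) :
    (∫⁻ x, f x) ^ p * (∫⁻ x, g x) ^ q ≤ ∫⁻ x, h x := by
  have hm := PiLp.volume_preserving_toLp (Fin n)
  rw [← hm.lintegral_comp hf, ← hm.lintegral_comp hg, ← hm.lintegral_comp hh]
  exact prekopa_leindler_pi hp hq hpq n (hf.comp hm.measurable) (hg.comp hm.measurable)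
    (hh.comp hm.measurable) fun x y ↦ H _ _

theorem lintegral_indicator_comp_smul {n : ℕ} {A : Set (EuclideanSpace ℝ (Fin n))}
    (hA : MeasurableSet A) {r : ℝ} (hr : 0 < r) :
    ∫⁻ x, A.indicator 1 (r • x) = ENNReal.ofReal ((r ^ n)⁻¹) * volume A := by
  have : (fun x ↦ A.indicator (1 : EuclideanSpace ℝ (Fin n) → ℝ≥0∞) (r • x)) =
      ((r • ·) ⁻¹' A).indicator 1 := rfl
  rw [this, lintegral_indicator_one (measurable_const_smul r hA),
    Measure.addHaar_preimage_smul _ hr.ne', finrank_euclideanSpace_fin,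
    abs_of_pos (by positivity)]

theorem pow_le_volume_real_of_combo_mem {n : ℕ} {A B C : Set (EuclideanSpace ℝ (Fin n))}
    (hA : MeasurableSet A) (hB : MeasurableSet B) (hC : MeasurableSet C) (hC' : volume C ≠ ∞)
    {p q α β : ℝ} (hp : 0 < p) (hq : 0 < q) (hα : 0 < α) (hβ : 0 < β)
    (hαA : volume.real A = α ^ n) (hβB : volume.real B = β ^ n)
    (h : ∀ a ∈ A, ∀ b ∈ B, p • a + q • b ∈ C) :
    (p * α + q * β) ^ n ≤ volume.real C := by
  have hN : 0 < p * α + q * β := by positivity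
  set N := p * α + q * β with hNdef
  have hone : ∀ {S : Set (EuclideanSpace ℝ (Fin n))} {r : ℝ}, 0 < r → volume.real S = r ^ n →
      ENNReal.ofReal ((r ^ n)⁻¹) * volume S = 1 := by
    intro S r hr hS
    have hfin : volume S ≠ ∞ := by
      intro htop
      have : volume.real S = 0 := by simp [Measure.real, htop]
      have : 0 < r ^ n := by positivity
      linarith
    rw [← ENNReal.ofReal_toReal hfin, ← Measure.real, hS, ← ENNReal.ofReal_mul (by positivity),
      inv_mul_cancel₀ (by positivity), ENNReal.ofReal_one]
  have hind : ∀ {S : Set (EuclideanSpace ℝ (Fin n))} (r : ℝ), MeasurableSet S →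
      Measurable fun x ↦ S.indicator (1 : EuclideanSpace ℝ (Fin n) → ℝ≥0∞) (r • x) :=
    fun r hS ↦ (measurable_one.indicator hS).comp (measurable_const_smul r)
  have key := prekopa_leindler (p := p * α / N) (q := q * β / N) (by positivity) (by positivity)
    (by rw [← add_div, ← hNdef, div_self hN.ne']) (hind α hA) (hind β hB) (hind N hC) (by
      intro x y
      by_cases hx : α • x ∈ A
      swap
      · simp [hx, ENNReal.zero_rpow_of_pos (show 0 < p * α / N by positivity)]
      by_cases hy : β • y ∈ B
      swap
      · simp [hy, ENNReal.zero_rpow_of_pos (show 0 < q * β / N by positivity)]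
      have hxy : N • ((p * α / N) • x + (q * β / N) • y) ∈ C := by
        have := h _ hx _ hy
        rwa [smul_add, smul_smul, smul_smul, mul_div_cancel₀ _ hN.ne', mul_div_cancel₀ _ hN.ne',
          mul_smul, mul_smul]
      simp [hx, hy, Set.indicator_of_mem hxy, -smul_add])
  rw [lintegral_indicator_comp_smul hA hα, lintegral_indicator_comp_smul hB hβ,
    lintegral_indicator_comp_smul hC hN, hone hα hαA, hone hβ hβB] at key
  rw [ENNReal.one_rpow, ENNReal.one_rpow, one_mul, ← ENNReal.ofReal_toReal hC',
    ← ENNReal.ofReal_mul (by positivity), ENNReal.one_le_ofReal, inv_mul_eq_div,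
    one_le_div (by positivity)] at key
  exact key

theorem pow_mul_volume_real_le_of_combo_mem {n : ℕ} {B C : Set (EuclideanSpace ℝ (Fin n))}
    (hC' : volume C ≠ ∞) {q : ℝ} (hq : 0 < q) (a : EuclideanSpace ℝ (Fin n))
    (h : ∀ b ∈ B, a + q • b ∈ C) :
    q ^ n * volume.real B ≤ volume.real C := by
  have hsub : a +ᵥ (q • B) ⊆ C := by
    rintro _ ⟨_, ⟨b, hb, rfl⟩, rfl⟩
    exact h b hb
  have := measureReal_mono hsub hC'
  rw [measureReal_def, measure_vadd, Measure.addHaar_smul_of_nonneg _ hq.le,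
    finrank_euclideanSpace_fin, ENNReal.toReal_mul, ENNReal.toReal_ofReal (by positivity)] at this
  exact this

/-- The Brunn–Minkowski inequality. -/
theorem brunn_minkowski {n : ℕ} (hn : n ≠ 0) {A B C : Set (EuclideanSpace ℝ (Fin n))}
    (hA : MeasurableSet A) (hB : MeasurableSet B) (hC : MeasurableSet C) (hC' : volume C ≠ ∞)
    (hA' : A.Nonempty) (hB' : B.Nonempty) {p q : ℝ} (hp : 0 < p) (hq : 0 < q)
    (h : ∀ a ∈ A, ∀ b ∈ B, p • a + q • b ∈ C) :
    p * volume.real A ^ (1 / n : ℝ) + q * volume.real B ^ (1 / n : ℝ) ≤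
      volume.real C ^ (1 / n : ℝ) := by
  obtain ⟨a, ha⟩ := hA'
  obtain ⟨b, hb⟩ := hB'
  have hpow : ∀ S : Set (EuclideanSpace ℝ (Fin n)),
      (volume.real S ^ (1 / n : ℝ)) ^ n = volume.real S := fun S ↦ by
    rw [one_div, Real.rpow_inv_natCast_pow measureReal_nonneg hn]
  have hα : 0 ≤ volume.real A ^ (1 / n : ℝ) := by positivity
  have hβ : 0 ≤ volume.real B ^ (1 / n : ℝ) := by positivity
  have hγ : 0 ≤ volume.real C ^ (1 / n : ℝ) := by positivity
  have hAn := hpow A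
  have hBn := hpow B
  have hCn := hpow C
  set α := volume.real A ^ (1 / n : ℝ)
  set β := volume.real B ^ (1 / n : ℝ)
  refine le_of_pow_le_pow_left₀ hn hγ ?_
  rw [hCn]
  rcases hα.eq_or_lt with h0 | hα
  · rw [← h0, mul_zero, zero_add, mul_pow, hBn]
    exact pow_mul_volume_real_le_of_combo_mem hC' hq (p • a) (h a ha)
  rcases hβ.eq_or_lt with h0 | hβ
  · rw [← h0, mul_zero, add_zero, mul_pow, hAn]
    exact pow_mul_volume_real_le_of_combo_mem hC' hp (q • b) fun x hx ↦ by
      simpa [add_comm] using h x hx b hb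
  exact pow_le_volume_real_of_combo_mem hA hB hC hC' hp hq hα hβ hAn.symm hBn.symm h

theorem ConcaveOn.exists_le_add_mul_sub {S : Set ℝ} {g : ℝ → ℝ} (hg : ConcaveOn ℝ S g) {m : ℝ}
    (hm : m ∈ interior S) : ∃ k, ∀ t ∈ S, g t ≤ g m + k * (t - m) := by
  have hn := hg.neg
  refine ⟨-derivWithin (-g) (Set.Ioi m) m, fun t ht ↦ ?_⟩
  rcases lt_trichotomy t m with h | rfl | h
  · have h1 := (hn.slope_le_leftDeriv_of_mem_interior ht hm h).trans
      (hn.leftDeriv_le_rightDeriv_of_mem_interior hm)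
    rw [slope_def_field, div_le_iff₀ (sub_pos.2 h)] at h1
    simp only [Pi.neg_apply] at h1
    linarith
  · simp
  · have h1 := hn.rightDeriv_le_slope_of_mem_interior hm ht h
    rw [slope_def_field, le_div_iff₀ (sub_pos.2 h)] at h1
    simp only [Pi.neg_apply] at h1
    linarith

section UpperPart

variable {E : Type*} [NormedAddCommGroup E] [MeasurableSpace E] [BorelSpace E] {μ : Measure E}
  {P : Set E} {X : E → ℝ}

/-- The tail `μ (P ∩ {t ≤ X})`, evaluated at `X`, stochastically dominates the uniform
distribution. -/
theorem measure_real_tail_lt_le [μ.InnerRegular] (hP : MeasurableSet P) (hPfin : μ P ≠ ∞)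
    (hX : Continuous X) (u : ℝ) (hu : 0 ≤ u) :
    μ.real {x ∈ P | μ.real {y ∈ P | X x ≤ X y} < u} ≤ u := by
  have hV : Antitone fun t ↦ μ.real {y ∈ P | t ≤ X y} := fun s t hst ↦
    measureReal_mono (fun y hy ↦ ⟨hy.1, hst.trans hy.2⟩)
      (ne_top_of_le_ne_top hPfin (measure_mono fun y hy ↦ hy.1))
  have hmeas : MeasurableSet {x ∈ P | μ.real {y ∈ P | X x ≤ X y} < u} :=
    hP.inter (measurableSet_lt (hV.measurable.comp hX.measurable) measurable_const)
  refine ENNReal.toReal_le_of_le_ofReal hu ?_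
  rw [hmeas.measure_eq_iSup_isCompact]
  refine iSup₂_le fun K hK ↦ iSup_le fun hKc ↦ ?_
  rcases K.eq_empty_or_nonempty with rfl | hne
  · simp
  obtain ⟨x, hx, hmin⟩ := hKc.exists_isMinOn hne hX.continuousOn
  have hfin : μ {y ∈ P | X x ≤ X y} ≠ ∞ :=
    ne_top_of_le_ne_top hPfin (measure_mono fun y hy ↦ hy.1)
  have hsub : K ⊆ {y ∈ P | X x ≤ X y} := fun y hy ↦ ⟨(hK hy).1, hmin hy⟩
  refine (measure_mono hsub).trans ?_
  rw [ENNReal.le_ofReal_iff_toReal_le hfin hu]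
  exact (hK hx).2.le

theorem integral_rpow_tail_ge [μ.InnerRegular] (hP : MeasurableSet P) (hPfin : μ P ≠ ∞)
    (hX : Continuous X) {n : ℕ} (hn : n ≠ 0) :
    (n : ℝ) / (n + 1) * (μ.real P * μ.real P ^ (1 / n : ℝ)) ≤
      ∫ x in P, μ.real {y ∈ P | X x ≤ X y} ^ (1 / n : ℝ) ∂μ ∧
    IntegrableOn (fun x ↦ μ.real {y ∈ P | X x ≤ X y} ^ (1 / n : ℝ)) P μ := by
  have hV : Antitone fun t ↦ μ.real {y ∈ P | t ≤ X y} := fun s t hst ↦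
    measureReal_mono (fun y hy ↦ ⟨hy.1, hst.trans hy.2⟩)
      (ne_top_of_le_ne_top hPfin (measure_mono fun y hy ↦ hy.1))
  set F : E → ℝ := fun x ↦ μ.real {y ∈ P | X x ≤ X y} ^ (1 / n : ℝ) with hF
  set R := μ.real P ^ (1 / n : ℝ)
  have hR : 0 ≤ R := by positivity
  have hRn : R ^ n = μ.real P := by
    simp only [R, one_div]
    exact Real.rpow_inv_natCast_pow measureReal_nonneg hn
  have hF0 : ∀ x, 0 ≤ F x := fun x ↦ by positivity
  have hFR : ∀ x, F x ≤ R := fun x ↦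
    Real.rpow_le_rpow measureReal_nonneg (measureReal_mono (fun y hy ↦ hy.1) hPfin) (by positivity)
  have hFm : Measurable F := (hV.measurable.comp hX.measurable).pow_const _
  have hFi : IntegrableOn F P μ :=
    Measure.integrableOn_of_bounded hPfin hFm.aestronglyMeasurable
      (Filter.Eventually.of_forall fun x ↦ by rw [Real.norm_of_nonneg (hF0 x)]; exact hFR x)
  refine ⟨?_, hFi⟩
  rw [Integrable.integral_eq_integral_Ioc_meas_le hFi (Filter.Eventually.of_forall hF0)
    (Filter.Eventually.of_forall hFR), ← intervalIntegral.integral_of_le hR]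
  have hcomp : ∫ s in (0 : ℝ)..R, (R ^ n - s ^ n) =
      (n : ℝ) / (n + 1) * (μ.real P * R) := by
    rw [intervalIntegral.integral_sub (by simp) (by simp), integral_pow, ← hRn]
    simp
    field_simp
    ring
  rw [← hcomp]
  have hanti : Antitone fun s : ℝ ↦ (μ.restrict P).real {x | s ≤ F x} := fun s t hst ↦
    measureReal_mono (fun y hy ↦ hst.trans hy)
      (ne_top_of_le_ne_top (by simpa using hPfin) (measure_mono (Set.subset_univ _)))
  refine intervalIntegral.integral_mono_on hR (Continuous.intervalIntegrable (by fun_prop) _ _)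
    (hanti.antitoneOn _).intervalIntegrable fun s hs ↦ ?_
  have hms : MeasurableSet {x | s ≤ F x} := measurableSet_le measurable_const hFm
  have hlt : μ.real (P \ {x | s ≤ F x}) ≤ s ^ n := by
    refine le_trans (measureReal_mono ?_ ?_)
      (measure_real_tail_lt_le hP hPfin hX (s ^ n) (pow_nonneg hs.1 n))
    · rintro x ⟨hx, hxs⟩
      refine ⟨hx, ?_⟩
      have := pow_lt_pow_left₀ (not_le.1 hxs) (hF0 x) hn
      rwa [hF, one_div, Real.rpow_inv_natCast_pow measureReal_nonneg hn] at this
    · exact ne_top_of_le_ne_top hPfin (measure_mono fun y hy ↦ hy.1)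
  have hsplit := measureReal_inter_add_sdiff (μ := μ) (s := P) hms hPfin
  rw [measureReal_restrict_apply hms, Set.inter_comm, hRn]
  linarith

end UpperPart

theorem concaveOn_rpow_volume_real_tail {n : ℕ} (hn : n ≠ 0) {P : Set (EuclideanSpace ℝ (Fin n))}
    (hP : IsCompact P) (hPc : Convex ℝ P) (w : EuclideanSpace ℝ (Fin n))
    {b : EuclideanSpace ℝ (Fin n)} (hb : b ∈ P) :
    ConcaveOn ℝ (Set.Iic ⟪w, b⟫) fun t ↦ volume.real {y ∈ P | t ≤ ⟪w, y⟫} ^ (1 / n : ℝ) := by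
  have hm : ∀ t : ℝ, MeasurableSet {y ∈ P | t ≤ ⟪w, y⟫} := fun t ↦
    hP.measurableSet.inter (measurableSet_le measurable_const
      (show Continuous fun y ↦ ⟪w, y⟫ by fun_prop).measurable)
  rw [concaveOn_iff_forall_pos]
  refine ⟨convex_Iic _, fun s hs t ht p q hp hq hpq ↦ ?_⟩
  refine brunn_minkowski hn (hm s) (hm t) (hm _) ?_ ⟨b, hb, hs⟩ ⟨b, hb, ht⟩ hp hq ?_
  · exact ne_top_of_le_ne_top hP.measure_lt_top.ne (measure_mono fun y hy ↦ hy.1)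
  · rintro x ⟨hx, hxs⟩ y ⟨hy, hyt⟩
    refine ⟨hPc hx hy hp.le hq.le hpq, ?_⟩
    rw [inner_add_right, real_inner_smul_right, real_inner_smul_right, smul_eq_mul, smul_eq_mul]
    gcongr

theorem setIntegral_inner_lt {n : ℕ} {P : Set (EuclideanSpace ℝ (Fin n))}
    (hP : IsCompact P) (hPint : (interior P).Nonempty)
    {w b : EuclideanSpace ℝ (Fin n)} (hw : w ≠ 0)
    (hmax : ∀ x ∈ P, ⟪w, x⟫ ≤ ⟪w, b⟫) :
    ∫ x in P, ⟪w, x⟫ < volume.real P * ⟪w, b⟫ := by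
  have hlt : ∀ x ∈ interior P, ⟪w, x⟫ < ⟪w, b⟫ := by
    intro x hx
    have hcont : Filter.Tendsto (fun ε : ℝ ↦ x + ε • w) (nhdsWithin 0 (Set.Ioi 0)) (nhds x) := by
      have : Continuous fun ε : ℝ ↦ x + ε • w := by fun_prop
      simpa using (this.tendsto 0).mono_left nhdsWithin_le_nhds
    obtain ⟨ε, hε, hε0⟩ := ((hcont.eventually (isOpen_interior.mem_nhds hx)).and
      self_mem_nhdsWithin).exists
    have h1 := hmax _ (interior_subset hε)
    rw [inner_add_right, real_inner_smul_right] at h1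
    have h2 : 0 < ε * ⟪w, w⟫ := mul_pos hε0 (real_inner_self_pos.2 hw)
    linarith
  have hXi : IntegrableOn (fun x ↦ ⟪w, x⟫) P :=
    ContinuousOn.integrableOn_compact hP (by fun_prop)
  have hci : IntegrableOn (fun _ ↦ ⟪w, b⟫) P := integrableOn_const hP.measure_lt_top.ne
  have hpos : 0 < ∫ x in P, (⟪w, b⟫ - ⟪w, x⟫) := by
    refine (setIntegral_pos_iff_support_of_nonneg_ae ?_ (hci.sub hXi)).2 ?_
    rotate_left
    · refine (isOpen_interior.measure_pos volume hPint).trans_le (measure_mono fun x hx ↦ ?_)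
      exact ⟨(sub_pos.2 (hlt x hx)).ne', interior_subset hx⟩
    · exact (ae_restrict_iff' hP.measurableSet).2
        (Filter.Eventually.of_forall fun x hx ↦ sub_nonneg.2 (hmax x hx))
  rw [integral_sub hci hXi, setIntegral_const, smul_eq_mul] at hpos
  linarith

theorem one_div_exp_one_le_pow {d : ℕ} (hd : 1 ≤ d) :
    1 / Real.exp 1 ≤ ((d : ℝ) / (d + 1)) ^ d := by
  have hd0 : (0 : ℝ) < d := by exact_mod_cast hd
  have h : ((d : ℝ) / (d + 1)) ^ d = 1 / (1 + 1 / (d : ℝ)) ^ d := by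
    rw [← one_div_pow]
    congr 1
    field_simp
  rw [h]
  refine one_div_le_one_div_of_le (by positivity) ?_
  calc (1 + 1 / (d : ℝ)) ^ d ≤ Real.exp (1 / d) ^ d := by
        gcongr
        linarith [Real.add_one_le_exp (1 / (d : ℝ))]
    _ = Real.exp 1 := by
        rw [← Real.exp_nat_mul, mul_one_div_cancel hd0.ne']

theorem grunbaum_inequality {d : ℕ} (hd : 1 ≤ d)
    (P : Set (EuclideanSpace ℝ (Fin d)))
    (hP : IsCompact P) (hPc : Convex ℝ P) (hPint : (interior P).Nonempty)
    (w : EuclideanSpace ℝ (Fin d)) (hw : w ≠ 0)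
    (c : EuclideanSpace ℝ (Fin d))
    (hc : c = (volume P).toReal⁻¹ • ∫ x in P, x) :
    ((d : ℝ) / (d + 1)) ^ d
        ≤ (volume (P ∩ {x | 0 ≤ ⟪w, x - c⟫})).toReal / (volume P).toReal ∧
      1 / Real.exp 1 ≤ ((d : ℝ) / (d + 1)) ^ d := by
  refine ⟨?_, one_div_exp_one_le_pow hd⟩
  have hd' : d ≠ 0 := by omega
  simp only [← measureReal_def] at hc ⊢
  have hPfin : volume P ≠ ∞ := hP.measure_lt_top.ne
  have hV0 : 0 < volume.real P :=
    ENNReal.toReal_pos (Measure.measure_pos_of_nonempty_interior volume hPint).ne' hPfin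
  have hX : Continuous fun x : EuclideanSpace ℝ (Fin d) ↦ ⟪w, x⟫ := by fun_prop
  have hXi : IntegrableOn (fun x ↦ ⟪w, x⟫) P := hX.continuousOn.integrableOn_compact hP
  have hwc : volume.real P * ⟪w, c⟫ = ∫ x in P, ⟪w, x⟫ := by
    have hid : IntegrableOn (fun x : EuclideanSpace ℝ (Fin d) ↦ x) P :=
      continuousOn_id.integrableOn_compact hP
    rw [hc, real_inner_smul_right, integral_inner hid, mul_inv_cancel_left₀ hV0.ne']
  obtain ⟨b, hb, hmax⟩ := hP.exists_isMaxOn (hPint.mono interior_subset) hX.continuousOn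
  have hcb : ⟪w, c⟫ < ⟪w, b⟫ := by
    have := setIntegral_inner_lt hP hPint hw hmax
    rw [← hwc] at this
    exact lt_of_mul_lt_mul_left this hV0.le
  obtain ⟨k, hk⟩ := (concaveOn_rpow_volume_real_tail hd' hP hPc w hb).exists_le_add_mul_sub
    (m := ⟪w, c⟫) (by rwa [interior_Iic])
  obtain ⟨hge, hint⟩ := integral_rpow_tail_ge (μ := volume) hP.measurableSet hPfin hX hd'
  set G := volume.real {y ∈ P | ⟪w, c⟫ ≤ ⟪w, y⟫}
  set R := volume.real P ^ (1 / d : ℝ)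
  have hjensen : ∫ x in P, volume.real {y ∈ P | ⟪w, x⟫ ≤ ⟪w, y⟫} ^ (1 / d : ℝ) ≤
      volume.real P * G ^ (1 / d : ℝ) := by
    have hconst : ∀ r : ℝ, IntegrableOn (fun _ : EuclideanSpace ℝ (Fin d) ↦ r) P :=
      fun r ↦ integrableOn_const hPfin
    have hlin : IntegrableOn (fun x ↦ k * (⟪w, x⟫ - ⟪w, c⟫)) P :=
      (hXi.sub (hconst _)).const_mul k
    refine (setIntegral_mono_on hint ((hconst (G ^ (1 / d : ℝ))).add hlin) hP.measurableSet
      fun x hx ↦ hk _ (hmax hx)).trans_eq ?_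
    simp only [Pi.add_apply]
    rw [integral_add (hconst _) hlin, integral_const_mul, integral_sub hXi (hconst _), ← hwc]
    simp
  have hRG : (d : ℝ) / (d + 1) * R ≤ G ^ (1 / d : ℝ) := by
    refine le_of_mul_le_mul_left ?_ hV0
    linarith
  have hset : P ∩ {x | 0 ≤ ⟪w, x - c⟫} = {y ∈ P | ⟪w, c⟫ ≤ ⟪w, y⟫} := by
    ext x
    simp [inner_sub_right]
  rw [hset, le_div_iff₀ hV0]
  have hpow := pow_le_pow_left₀ (by positivity) hRG d
  rw [mul_pow] at hpow
  simp only [R, one_div] at hpow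
  rwa [Real.rpow_inv_natCast_pow measureReal_nonneg hd',
    Real.rpow_inv_natCast_pow measureReal_nonneg hd'] at hpow
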